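/- arXiv:2012.07256 — 3 statements merged into one kernel-verified Lean document; each statement's English description precedes it below -/
import Mathlib

section
/- Fix 0 < a < b, t > 0 and ν > 0. Let κ⁽¹⁾(z) = (b/(b−a) − (a/(b−a)) e^{−(b−a)(t−z)}) · 1_{[0,t]}(z), κ⁽²⁾(z) = Σ_{m=1}^∞ (Γᵐ (κ⁽¹⁾)²)(z), and define the third cumulant κ⁽³⁾(t) = ν ∫₀^t Σ_{m=0}^∞ (Γᵐ (3 κ⁽¹⁾ κ⁽²⁾ + (κ⁽¹⁾)³))(z) dz, where Γ⁰ is the identity. Then κ⁽³⁾(t) = −(ν/(6(a−b)⁶)) (42ab⁴ + 30a²b³ − 7a³b² + a⁴b + 6b⁴(2a² − ab − b²)t + 3(18a³b² − 16a²b³ − a⁴b − 14ab⁴ − 2a⁵ + 6a²b(4ab² − 4b³ + a²b − a³)t − 6a³b²(a−b)²t²) e^{(a−b)t} + 9(2a²b³ − 5a³b² − a⁴b + 2a⁵ + 2a³b(b² − 3ab + 2a²)t) e^{2(a−b)t} − a³(2b² − 11ab + 12a²) e^{3(a−b)t}). -/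
open MeasureTheory

/-- The integral operator `(Γf)(z) = a ∫₀^∞ f(z+y) e^{-by} dy`. -/
noncomputable def hawkesGamma (a b : ℝ) (f : ℝ → ℝ) : ℝ → ℝ :=
  fun z => a * ∫ y in Set.Ioi (0 : ℝ), f (z + y) * Real.exp (-b * y)

open Set Filter Topology

section Gamma

variable {a b : ℝ} {f g : ℝ → ℝ} {M N : ℝ}

theorem integrableOn_shift_mul_exp (hb : 0 < b) (hf : Measurable f) (hM : ∀ z, |f z| ≤ M)
    (z : ℝ) : IntegrableOn (fun y => f (z + y) * Real.exp (-b * y)) (Ioi 0) := by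
  refine Integrable.bdd_mul (c := M) (exp_neg_integrableOn_Ioi 0 hb) ?_ ?_
  · exact (hf.comp (measurable_const_add z)).aestronglyMeasurable
  · exact ae_of_all _ fun y => hM _

theorem measurable_hawkesGamma (hf : Measurable f) : Measurable (hawkesGamma a b f) := by
  have : StronglyMeasurable
      (Function.uncurry fun z y : ℝ => f (z + y) * Real.exp (-b * y)) := by
    apply Measurable.stronglyMeasurable
    simp only [Function.uncurry_def]
    fun_prop
  exact (this.integral_prod_right (ν := volume.restrict (Ioi 0))).measurable.const_mul a

theorem abs_hawkesGamma_le (ha : 0 ≤ a) (hb : 0 < b) (hM : ∀ z, |f z| ≤ M) (z : ℝ) :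
    |hawkesGamma a b f z| ≤ a / b * M := by
  have hint : ∫ y in Ioi (0 : ℝ), M * Real.exp (-b * y) = M / b := by
    rw [integral_const_mul, integral_exp_mul_Ioi (by linarith)]
    simp [div_eq_mul_inv]
  have h : ‖∫ y in Ioi (0 : ℝ), f (z + y) * Real.exp (-b * y)‖ ≤ M / b := by
    rw [← hint]
    refine norm_integral_le_of_norm_le ((exp_neg_integrableOn_Ioi 0 hb).const_mul M)
      (ae_of_all _ fun y => ?_)
    rw [norm_mul, Real.norm_eq_abs, Real.norm_eq_abs, Real.abs_exp]
    exact mul_le_mul_of_nonneg_right (hM _) (Real.exp_pos _).le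
  rw [hawkesGamma, abs_mul, abs_of_nonneg ha]
  calc a * |∫ y in Ioi (0 : ℝ), f (z + y) * Real.exp (-b * y)|
      ≤ a * (M / b) := mul_le_mul_of_nonneg_left h ha
    _ = a / b * M := by ring

theorem measurable_iterate_hawkesGamma (hf : Measurable f) (n : ℕ) :
    Measurable ((hawkesGamma a b)^[n] f) := by
  induction n with
  | zero => exact hf
  | succ n ih =>
    rw [Function.iterate_succ_apply']
    exact measurable_hawkesGamma ih

theorem abs_iterate_hawkesGamma_le (ha : 0 ≤ a) (hb : 0 < b) (hM : ∀ z, |f z| ≤ M) (n : ℕ)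
    (z : ℝ) : |(hawkesGamma a b)^[n] f z| ≤ (a / b) ^ n * M := by
  induction n generalizing z with
  | zero => simpa using hM z
  | succ n ih =>
    rw [Function.iterate_succ_apply', pow_succ', mul_assoc]
    exact abs_hawkesGamma_le ha hb ih z

theorem hawkesGamma_add_apply (hb : 0 < b) (hf : Measurable f) (hM : ∀ z, |f z| ≤ M)
    (hg : Measurable g) (hN : ∀ z, |g z| ≤ N) (z : ℝ) :
    hawkesGamma a b (f + g) z = hawkesGamma a b f z + hawkesGamma a b g z := by
  simp only [hawkesGamma, Pi.add_apply, add_mul]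
  rw [integral_add (integrableOn_shift_mul_exp hb hf hM z)
    (integrableOn_shift_mul_exp hb hg hN z), mul_add]

theorem hawkesGamma_eqOn_Ici {z₀ : ℝ} (h : EqOn f g (Ici z₀)) :
    EqOn (hawkesGamma a b f) (hawkesGamma a b g) (Ici z₀) := by
  intro z hz
  simp only [hawkesGamma]
  congr 1
  refine setIntegral_congr_fun measurableSet_Ioi fun y hy => ?_
  have : z + y ∈ Ici z₀ := by
    simp only [mem_Ici, mem_Ioi] at *
    linarith
  simp only [h this]

/-- A bounded solution on `[z₀, ∞)` of the renewal equation `F = f + Γ F` is the Neumann series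
of `f`. -/
theorem hasSum_iterate_hawkesGamma {F : ℝ → ℝ} {z₀ : ℝ} (ha : 0 ≤ a) (hab : a < b)
    (hf : Measurable f) (hM : ∀ z, |f z| ≤ M) (hF : Measurable F) (hN : ∀ z, |F z| ≤ N)
    (h : ∀ z ∈ Ici z₀, F z = f z + hawkesGamma a b F z) {z : ℝ} (hz : z ∈ Ici z₀) :
    HasSum (fun m : ℕ => (hawkesGamma a b)^[m] f z) (F z) := by
  have hb : 0 < b := ha.trans_lt hab
  have hr : 0 ≤ a / b := div_nonneg ha hb.le
  have hr1 : a / b < 1 := (div_lt_one hb).2 hab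
  have step : ∀ n : ℕ, EqOn ((hawkesGamma a b)^[n] F)
      ((hawkesGamma a b)^[n] f + (hawkesGamma a b)^[n + 1] F) (Ici z₀) := by
    intro n
    induction n with
    | zero => exact h
    | succ n ih =>
      intro w hw
      rw [Function.iterate_succ_apply', hawkesGamma_eqOn_Ici ih hw,
        hawkesGamma_add_apply hb (measurable_iterate_hawkesGamma hf n)
          (abs_iterate_hawkesGamma_le ha hb hM n) (measurable_iterate_hawkesGamma hF (n + 1))
          (abs_iterate_hawkesGamma_le ha hb hN (n + 1)),
        Pi.add_apply, ← Function.iterate_succ_apply' (hawkesGamma a b),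
        ← Function.iterate_succ_apply' (hawkesGamma a b)]
  have hsum : Summable fun m : ℕ => (hawkesGamma a b)^[m] f z :=
    Summable.of_norm_bounded ((summable_geometric_of_lt_one hr hr1).mul_right M)
      fun m => abs_iterate_hawkesGamma_le ha hb hM m z
  have hpartial : ∀ n : ℕ, ∑ m ∈ Finset.range n, (hawkesGamma a b)^[m] f z
      = F z - (hawkesGamma a b)^[n] F z := by
    intro n
    induction n with
    | zero => simp
    | succ n ih =>
      rw [Finset.sum_range_succ, ih, step n hz, Pi.add_apply]
      ring
  have hlim : Tendsto (fun n : ℕ => (hawkesGamma a b)^[n] F z) atTop (𝓝 0) := by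
    refine squeeze_zero_norm (fun n => abs_iterate_hawkesGamma_le ha hb hN n z) ?_
    simpa using (tendsto_pow_atTop_nhds_zero_of_lt_one hr hr1).mul_const N
  refine (hsum.hasSum_iff_tendsto_nat).2 ?_
  simp only [hpartial]
  simpa using hlim.const_sub (F z)

end Gamma

section Window

variable {a b t : ℝ} {g h : ℝ → ℝ}

theorem measurable_indicator_reflect (hg : Continuous g) :
    Measurable (indicator (Icc 0 t) fun w => g (t - w)) :=
  (hg.comp (continuous_const.sub continuous_id)).measurable.indicator measurableSet_Icc

theorem exists_abs_indicator_reflect_le (hg : Continuous g) :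
    ∃ M, ∀ z, |indicator (Icc 0 t) (fun w => g (t - w)) z| ≤ M := by
  obtain ⟨M, hM⟩ := isCompact_Icc.exists_bound_of_continuousOn (s := Icc 0 t)
    (hg.comp (continuous_const.sub continuous_id)).continuousOn
  refine ⟨max M 0, fun z => ?_⟩
  by_cases hz : z ∈ Icc 0 t
  · rw [indicator_of_mem hz]
    exact (hM z hz).trans (le_max_left _ _)
  · rw [indicator_of_notMem hz, abs_zero]
    exact le_max_right _ _

/-- In the reflected variable `s = t - z` the operator `Γ` becomes a first-order linear ODE. -/
theorem hawkesGamma_indicator_reflect (hg : Continuous g) (h0 : h 0 = 0)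
    (hd : ∀ s, HasDerivAt h (a * g s - (b - a) * h s) s) {z : ℝ} (hz : 0 ≤ z) :
    hawkesGamma a b (indicator (Icc 0 t) fun w => g (t - w) + h (t - w)) z
      = indicator (Icc 0 t) (fun w => h (t - w)) z := by
  have hh : Continuous h := continuous_iff_continuousAt.2 fun s => (hd s).continuousAt
  by_cases hzt : z ≤ t
  · have key : ∫ y in Ioi (0 : ℝ),
        indicator (Icc 0 t) (fun w => g (t - w) + h (t - w)) (z + y) * Real.exp (-b * y)
        = ∫ y in (0 : ℝ)..(t - z),
          (g (t - z - y) + h (t - z - y)) * Real.exp (-b * y) := by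
      rw [intervalIntegral.integral_of_le (by linarith), ← Ioi_inter_Iic,
        ← setIntegral_indicator measurableSet_Iic]
      refine setIntegral_congr_fun measurableSet_Ioi fun y hy => ?_
      have hy' : 0 < y := hy
      by_cases hyt : y ≤ t - z
      · simp only [indicator_of_mem (show y ∈ Iic (t - z) from hyt),
          indicator_of_mem (show z + y ∈ Icc 0 t from ⟨by linarith, by linarith⟩), sub_sub]
      · simp only [indicator_of_notMem (show y ∉ Iic (t - z) from hyt),
          indicator_of_notMem (show z + y ∉ Icc 0 t from fun hm => hyt (by linarith [hm.2])),
          zero_mul]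
    have anti : ∀ y ∈ uIcc (0 : ℝ) (t - z),
        HasDerivAt (fun y => -(h (t - z - y) * Real.exp (-b * y)))
          (a * ((g (t - z - y) + h (t - z - y)) * Real.exp (-b * y))) y := by
      intro y _
      have h1 : HasDerivAt (fun y => h (t - z - y))
          ((a * g (t - z - y) - (b - a) * h (t - z - y)) * (-1)) y :=
        (hd (t - z - y)).comp y ((hasDerivAt_id y).const_sub (t - z))
      have h2 : HasDerivAt (fun y => Real.exp (-b * y)) (Real.exp (-b * y) * (-b * 1)) y :=
        ((hasDerivAt_id y).const_mul (-b)).exp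
      refine (h1.mul h2).neg.congr_deriv ?_
      ring
    rw [indicator_of_mem (show z ∈ Icc 0 t from ⟨hz, hzt⟩), hawkesGamma, key,
      ← intervalIntegral.integral_const_mul,
      intervalIntegral.integral_eq_sub_of_hasDerivAt anti
        (Continuous.intervalIntegrable (by fun_prop) _ _)]
    simp [h0]
  · rw [indicator_of_notMem (fun hm => hzt hm.2), hawkesGamma]
    have : EqOn (fun y => indicator (Icc 0 t) (fun w => g (t - w) + h (t - w)) (z + y)
        * Real.exp (-b * y)) 0 (Ioi 0) := by
      intro y hy
      have hy' : 0 < y := hy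
      simp only [indicator_of_notMem
        (show z + y ∉ Icc 0 t from fun hm => hzt (by linarith [hm.2])), zero_mul, Pi.zero_apply]
    rw [setIntegral_congr_fun measurableSet_Ioi this]
    simp

theorem hasSum_iterate_hawkesGamma_reflect (ha : 0 ≤ a) (hab : a < b) (hg : Continuous g)
    (h0 : h 0 = 0) (hd : ∀ s, HasDerivAt h (a * g s - (b - a) * h s) s) {z : ℝ}
    (hz : z ∈ Icc 0 t) :
    HasSum (fun m : ℕ => (hawkesGamma a b)^[m] (indicator (Icc 0 t) fun w => g (t - w)) z)
      (g (t - z) + h (t - z)) := by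
  have hh : Continuous h := continuous_iff_continuousAt.2 fun s => (hd s).continuousAt
  obtain ⟨M, hM⟩ := exists_abs_indicator_reflect_le (t := t) hg
  obtain ⟨N, hN⟩ := exists_abs_indicator_reflect_le (t := t) (hg.add hh)
  have := hasSum_iterate_hawkesGamma (z₀ := 0) ha hab (measurable_indicator_reflect hg) hM
    (measurable_indicator_reflect (hg.add hh)) hN
    (fun w hw => by
      simp only [Pi.add_apply]
      rw [hawkesGamma_indicator_reflect hg h0 hd hw, ← Pi.add_apply, ← indicator_add']
      rfl)
    (z := z) hz.1
  rwa [indicator_of_mem hz] at this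

end Window

/-- Polynomials in `s` and `e^{-cs}` of the shape occurring in the Hawkes cumulants. -/
noncomputable def expPoly (c p₀ p₁ q₀ q₁ q₂ r₀ r₁ u₀ s : ℝ) : ℝ :=
  p₀ + p₁ * s + (q₀ + q₁ * s + q₂ * s ^ 2) * Real.exp (-c * s)
    + (r₀ + r₁ * s) * Real.exp (-c * s) ^ 2 + u₀ * Real.exp (-c * s) ^ 3

theorem hasDerivAt_expPoly (c p₀ p₁ q₀ q₁ q₂ r₀ r₁ u₀ s : ℝ) :
    HasDerivAt (expPoly c p₀ p₁ q₀ q₁ q₂ r₀ r₁ u₀)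
      (expPoly c p₁ 0 (q₁ - c * q₀) (2 * q₂ - c * q₁) (-c * q₂)
        (r₁ - 2 * c * r₀) (-2 * c * r₁) (-3 * c * u₀) s) s := by
  have he : HasDerivAt (fun s => Real.exp (-c * s)) (Real.exp (-c * s) * (-c * 1)) s :=
    ((hasDerivAt_id s).const_mul (-c)).exp
  have hs := hasDerivAt_id s
  have h := ((((hs.const_mul p₁).const_add p₀).add
    ((((hs.const_mul q₁).const_add q₀).add ((hs.pow 2).const_mul q₂)).mul he)).add
    (((hs.const_mul r₁).const_add r₀).mul (he.pow 2))).add ((he.pow 3).const_mul u₀)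
  refine (h.congr_deriv ?_)
  simp [expPoly]
  ring

theorem differentiable_expPoly (c p₀ p₁ q₀ q₁ q₂ r₀ r₁ u₀ : ℝ) :
    Differentiable ℝ (expPoly c p₀ p₁ q₀ q₁ q₂ r₀ r₁ u₀) :=
  fun s => (hasDerivAt_expPoly c p₀ p₁ q₀ q₁ q₂ r₀ r₁ u₀ s).differentiableAt

theorem deriv_expPoly (c p₀ p₁ q₀ q₁ q₂ r₀ r₁ u₀ : ℝ) :
    deriv (expPoly c p₀ p₁ q₀ q₁ q₂ r₀ r₁ u₀)
      = expPoly c p₁ 0 (q₁ - c * q₀) (2 * q₂ - c * q₁) (-c * q₂)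
        (r₁ - 2 * c * r₀) (-2 * c * r₁) (-3 * c * u₀) :=
  funext fun s => (hasDerivAt_expPoly c p₀ p₁ q₀ q₁ q₂ r₀ r₁ u₀ s).deriv

/-- Third cumulant of the Hawkes process with immigration rate `ν`:
`κ⁽³⁾(t) = ν ∫₀^t Σ_{m≥0} Γᵐ(3κ⁽¹⁾κ⁽²⁾ + (κ⁽¹⁾)³)(z) dz` equals the stated
closed-form expression. -/
theorem hawkes_third_cumulant (a b t ν : ℝ) (ha : 0 < a) (hab : a < b) (ht : 0 < t)
    (hν : 0 < ν)
    (κ₁ κ₂ : ℝ → ℝ)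
    (hκ₁ : κ₁ = Set.indicator (Set.Icc (0 : ℝ) t)
      (fun z => b / (b - a) - a / (b - a) * Real.exp (-(b - a) * (t - z))))
    (hκ₂ : ∀ z : ℝ, κ₂ z = ∑' m : ℕ, (hawkesGamma a b)^[m + 1] (fun w => (κ₁ w) ^ 2) z) :
    ν * ∫ z in (0 : ℝ)..t,
        (∑' m : ℕ, (hawkesGamma a b)^[m] (fun w => 3 * κ₁ w * κ₂ w + (κ₁ w) ^ 3) z)
      = -(ν / (6 * (a - b) ^ 6)) *
          (42 * a * b ^ 4 + 30 * a ^ 2 * b ^ 3 - 7 * a ^ 3 * b ^ 2 + a ^ 4 * b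
            + 6 * b ^ 4 * (2 * a ^ 2 - a * b - b ^ 2) * t
            + 3 * (18 * a ^ 3 * b ^ 2 - 16 * a ^ 2 * b ^ 3 - a ^ 4 * b - 14 * a * b ^ 4
                - 2 * a ^ 5
                + 6 * a ^ 2 * b * (4 * a * b ^ 2 - 4 * b ^ 3 + a ^ 2 * b - a ^ 3) * t
                - 6 * a ^ 3 * b ^ 2 * (a - b) ^ 2 * t ^ 2) * Real.exp ((a - b) * t)
            + 9 * (2 * a ^ 2 * b ^ 3 - 5 * a ^ 3 * b ^ 2 - a ^ 4 * b + 2 * a ^ 5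
                + 2 * a ^ 3 * b * (b ^ 2 - 3 * a * b + 2 * a ^ 2) * t) *
                Real.exp (2 * (a - b) * t)
            - a ^ 3 * (2 * b ^ 2 - 11 * a * b + 12 * a ^ 2) * Real.exp (3 * (a - b) * t)) := by
  obtain ⟨c, rfl⟩ : ∃ c, b = a + c := ⟨b - a, by ring⟩
  have hc : 0 < c := by linarith
  have hc0 : c ≠ 0 := hc.ne'
  set b := a + c with hb
  have hbc : b - a = c := by rw [hb]; ring
  have hac : a - b = -c := by rw [hb]; ring
  set k : ℝ → ℝ := expPoly c (b / c) 0 (-(a / c)) 0 0 0 0 0 with hk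
  set h₂ : ℝ → ℝ := expPoly c (a * b ^ 2 / c ^ 3) 0 (-(a * (a + b) / c ^ 2))
    (-(2 * a ^ 2 * b / c ^ 2)) 0 (-(a ^ 3 / c ^ 3)) 0 0 with hh₂
  set K : ℝ → ℝ := expPoly c
    (-(42 * a * b ^ 4 + 30 * a ^ 2 * b ^ 3 - 7 * a ^ 3 * b ^ 2 + a ^ 4 * b) / (6 * c ^ 6))
    (-(b ^ 4 * (2 * a ^ 2 - a * b - b ^ 2)) / c ^ 6)
    (-(18 * a ^ 3 * b ^ 2 - 16 * a ^ 2 * b ^ 3 - a ^ 4 * b - 14 * a * b ^ 4 - 2 * a ^ 5)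
      / (2 * c ^ 6))
    (-(3 * a ^ 2 * b * (4 * a * b ^ 2 - 4 * b ^ 3 + a ^ 2 * b - a ^ 3)) / c ^ 6)
    (3 * a ^ 3 * b ^ 2 / c ^ 4)
    (-(3 * (2 * a ^ 2 * b ^ 3 - 5 * a ^ 3 * b ^ 2 - a ^ 4 * b + 2 * a ^ 5)) / (2 * c ^ 6))
    (-(3 * a ^ 3 * b * (b ^ 2 - 3 * a * b + 2 * a ^ 2)) / c ^ 6)
    (a ^ 3 * (2 * b ^ 2 - 11 * a * b + 12 * a ^ 2) / (6 * c ^ 6)) with hK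
  have kd := hasDerivAt_expPoly c (b / c) 0 (-(a / c)) 0 0 0 0 0
  rw [← hk] at kd
  have h₂d : ∀ s, HasDerivAt h₂ (a * k s ^ 2 - (b - a) * h₂ s) s := by
    intro s
    refine (hasDerivAt_expPoly _ _ _ _ _ _ _ _ _ s).congr_deriv ?_
    rw [hbc, hk, hh₂]
    simp only [expPoly]
    field_simp
    rw [hb]
    ring
  have hkc : Continuous k := continuous_iff_continuousAt.2 fun s => (kd s).continuousAt
  have hhc : Continuous h₂ := continuous_iff_continuousAt.2 fun s => (h₂d s).continuousAt
  set g : ℝ → ℝ := fun s => 3 * k s * h₂ s + k s ^ 3 with hg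
  have hgc : Continuous g := by fun_prop
  have hKd : Differentiable ℝ K := hK ▸ differentiable_expPoly _ _ _ _ _ _ _ _ _
  have hKd' : Differentiable ℝ (deriv K) := by
    rw [hK, deriv_expPoly]
    exact differentiable_expPoly _ _ _ _ _ _ _ _ _
  set h₃ : ℝ → ℝ := fun s => deriv K s - g s with hh₃
  have h₃d : ∀ s, HasDerivAt h₃ (a * g s - (b - a) * h₃ s) s := by
    intro s
    refine ((hKd' s).hasDerivAt.sub
      ((((kd s).const_mul 3).mul (h₂d s)).add ((kd s).pow 3))).congr_deriv ?_
    rw [hh₃, hK, deriv_expPoly, deriv_expPoly]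
    rw [hbc, hg, hk, hh₂]
    simp only [expPoly, Nat.reduceSub, Nat.cast_ofNat]
    field_simp
    rw [hb]
    ring
  have h₂0 : h₂ 0 = 0 := by
    rw [hh₂]
    simp only [expPoly, mul_zero, Real.exp_zero]
    field_simp
    rw [hb]
    ring
  have h₃0 : h₃ 0 = 0 := by
    simp only [hh₃, hK, deriv_expPoly, hg, h₂0, hk]
    simp only [expPoly, mul_zero, Real.exp_zero]
    field_simp
    rw [hb]
    ring
  have hκ₁' : κ₁ = indicator (Icc 0 t) fun w => k (t - w) := by
    rw [hκ₁]
    congr 1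
    funext w
    simp only [hk, expPoly, hbc]
    ring
  have hsq : (fun w => κ₁ w ^ 2) = indicator (Icc 0 t) fun w => k (t - w) ^ 2 := by
    funext w
    by_cases hw : w ∈ Icc 0 t <;> simp [hκ₁', hw]
  have hκ₂' : ∀ z ∈ Icc 0 t, κ₂ z = h₂ (t - z) := by
    intro z hz
    have hs := hasSum_iterate_hawkesGamma_reflect (g := fun s => k s ^ 2) ha.le hab (hkc.pow 2) h₂0 h₂d hz
    have h1 := (hasSum_nat_add_iff' 1).2 hs
    rw [hκ₂ z, hsq, h1.tsum_eq]
    simp [hz]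
  have hcub : (fun w => 3 * κ₁ w * κ₂ w + κ₁ w ^ 3) = indicator (Icc 0 t) fun w => g (t - w) := by
    funext w
    by_cases hw : w ∈ Icc 0 t
    · simp [hκ₁', hw, hκ₂' w hw, hg]
    · simp [hκ₁', hw]
  have hint : ∫ z in (0 : ℝ)..t,
      (∑' m : ℕ, (hawkesGamma a b)^[m] (fun w => 3 * κ₁ w * κ₂ w + (κ₁ w) ^ 3) z)
      = ∫ z in (0 : ℝ)..t, deriv K (t - z) := by
    refine intervalIntegral.integral_congr fun z hz => ?_
    rw [uIcc_of_le ht.le] at hz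
    simp only [hcub]
    rw [(hasSum_iterate_hawkesGamma_reflect ha.le hab hgc h₃0 h₃d hz).tsum_eq]
    simp [hh₃]
  rw [hint, intervalIntegral.integral_comp_sub_left (deriv K) t, sub_self, sub_zero,
    intervalIntegral.integral_deriv_eq_sub (fun s _ => hKd s)
      (hKd'.continuous.intervalIntegrable _ _), hac,
    show Real.exp (2 * -c * t) = Real.exp (-c * t) ^ 2 by rw [← Real.exp_nat_mul]; ring_nf,
    show Real.exp (3 * -c * t) = Real.exp (-c * t) ^ 3 by rw [← Real.exp_nat_mul]; ring_nf, hK]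
  simp only [expPoly, mul_zero, Real.exp_zero]
  field_simp
  ring
end

section
/- Fix 0 < a < b, t > 0 and ν > 0. Let κ⁽¹⁾(z) = (b/(b−a) − (a/(b−a)) e^{−(b−a)(t−z)}) · 1_{[0,t]}(z), κ⁽²⁾(z) = Σ_{m=1}^∞ (Γᵐ (κ⁽¹⁾)²)(z), κ⁽³⁾(z) = Σ_{m=1}^∞ (Γᵐ (3 κ⁽¹⁾ κ⁽²⁾ + (κ⁽¹⁾)³))(z), and define the fourth cumulant κ⁽⁴⁾(t) = ν ∫₀^t Σ_{m=0}^∞ (Γᵐ (6 (κ⁽¹⁾)² κ⁽²⁾ + 4 κ⁽¹⁾ κ⁽³⁾ + 3 (κ⁽²⁾)² + (κ⁽¹⁾)⁴))(z) dz, where Γ⁰ is the identity. Then κ⁽⁴⁾(t) = −(ν/(12(a−b)⁸)) (180ab⁶ + 570a²b⁵ + 100a³b⁴ − 15a⁴b³ + 2a⁵b² + 12b⁵(6a³ + 2a²b − b³ − 7ab²)t + 4(5a⁶b − 45ab⁶ + 3a⁷ − 59a⁵b² − 180a²b⁵ + 75a³b⁴ + 75a⁴b³ + 6a²b(5ab⁴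 − 25b⁵ + 41a²b³ − 22a³b² − a⁴b + 2a⁵)t + 18a³b²(10ab³ − 5b⁴ − 4a²b² − 2a³b + a⁴)t² + 12a⁴b³(a−b)³t³) e^{(a−b)t} + (150a²b⁵ − 360a³b⁴ − 564a⁴b³ + 588a⁵b² + 18a⁶b − 84a⁷ + 4a³b(90b⁴ − 306ab³ + 180a²b² + 108a³b − 72a⁴)t + 144a⁴b²(−4ab² + b³ + 5a²b − 2a³)t²) e^{2(a−b)t} + (276a⁴b³ − 40a³b⁴ − 132a⁶b − 320a⁵b² + 144a⁷ + 24a⁴b(13ab² − 23a²b − 2b³ + 12a³)t) e^{3(a−b)t} + a⁴(3b³ − 34ab² + 94a²b − 72a³) e^{4(a−b)t}). -/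
open MeasureTheory

section TruncatedOperator

variable {a b t : ℝ}

/-- The operator `hawkesGamma` on functions that vanish after time `t`, as an integral over
`[z, t]`. -/
noncomputable def truncGamma (a b t : ℝ) (g : ℝ → ℝ) : ℝ → ℝ :=
  fun z => a * ∫ w in z..t, g w * Real.exp (-b * (w - z))

theorem hawkesGamma_eq_truncGamma {f g : ℝ → ℝ}
    (hf : ∀ z, 0 ≤ z → f z = if z ≤ t then g z else 0) {z : ℝ} (hz : 0 ≤ z) :
    hawkesGamma a b f z = if z ≤ t then truncGamma a b t g z else 0 := by
  have key : ∫ y in Set.Ioi (0 : ℝ), f (z + y) * Real.exp (-b * y)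
      = ∫ y in Set.Ioc 0 (t - z), g (z + y) * Real.exp (-b * y) := by
    rw [← Set.Ioi_inter_Iic, ← setIntegral_indicator measurableSet_Iic]
    refine setIntegral_congr_fun measurableSet_Ioi fun y hy => ?_
    have hy0 : (0 : ℝ) < y := hy
    by_cases h : y ≤ t - z
    · simp [Set.indicator, h, hf (z + y) (by linarith), show z + y ≤ t by linarith]
    · simp [Set.indicator, h, hf (z + y) (by linarith), show ¬ z + y ≤ t by linarith]
  unfold hawkesGamma truncGamma
  rw [key]
  split_ifs with h
  · rw [← intervalIntegral.integral_of_le (by linarith)]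
    have := intervalIntegral.integral_comp_add_left (a := 0) (b := t - z)
      (fun w => g w * Real.exp (-b * (w - z))) z
    simp only [add_sub_cancel_left, add_zero, add_sub_cancel] at this
    rw [this]
  · simp [Set.Ioc_eq_empty (show ¬ (0 : ℝ) < t - z by linarith)]

theorem continuous_truncGamma {g : ℝ → ℝ} (hg : Continuous g) :
    Continuous (truncGamma a b t g) := by
  have h : truncGamma a b t g =
      fun z => -(a * Real.exp (b * z) * ∫ w in t..z, g w * Real.exp (-b * w)) := by
    funext z
    have : ∀ w, g w * Real.exp (-b * (w - z))
        = Real.exp (b * z) * (g w * Real.exp (-b * w)) := fun w => by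
      rw [show -b * (w - z) = b * z + -b * w by ring, Real.exp_add]
      ring
    simp only [truncGamma, this, intervalIntegral.integral_const_mul]
    rw [intervalIntegral.integral_symm]
    ring
  have hp : Continuous fun z => ∫ w in t..z, g w * Real.exp (-b * w) :=
    intervalIntegral.continuous_primitive
      (fun _ _ => Continuous.intervalIntegrable (by fun_prop) _ _) t
  rw [h]
  fun_prop

theorem continuous_iterate_truncGamma {g : ℝ → ℝ} (hg : Continuous g) (m : ℕ) :
    Continuous ((truncGamma a b t)^[m] g) := by
  induction m with
  | zero => exact hg
  | succ m ih =>
    rw [Function.iterate_succ_apply']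
    exact continuous_truncGamma ih

theorem iterate_hawkesGamma_eq_truncGamma {f g : ℝ → ℝ}
    (hf : ∀ z, 0 ≤ z → f z = if z ≤ t then g z else 0) (m : ℕ) :
    ∀ z, 0 ≤ z →
      (hawkesGamma a b)^[m] f z = if z ≤ t then (truncGamma a b t)^[m] g z else 0 := by
  induction m with
  | zero => exact hf
  | succ m ih =>
    intro z hz
    simp only [Function.iterate_succ_apply']
    exact hawkesGamma_eq_truncGamma ih hz

theorem truncGamma_add {f g : ℝ → ℝ} (hf : Continuous f) (hg : Continuous g) :
    truncGamma a b t (f + g) = truncGamma a b t f + truncGamma a b t g := by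
  funext z
  simp only [truncGamma, Pi.add_apply, add_mul]
  rw [intervalIntegral.integral_add (Continuous.intervalIntegrable (by fun_prop) _ _)
    (Continuous.intervalIntegrable (by fun_prop) _ _), mul_add]

theorem iterate_truncGamma_add {f g : ℝ → ℝ} (hf : Continuous f) (hg : Continuous g) (m : ℕ) :
    (truncGamma a b t)^[m] (f + g) = (truncGamma a b t)^[m] f + (truncGamma a b t)^[m] g := by
  induction m with
  | zero => rfl
  | succ m ih =>
    simp only [Function.iterate_succ_apply', ih]
    exact truncGamma_add (continuous_iterate_truncGamma hf m) (continuous_iterate_truncGamma hg m)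

theorem abs_truncGamma_le (ha : 0 < a) (hb : 0 < b) {g : ℝ → ℝ} {C : ℝ}
    (hC : ∀ z ∈ Set.Icc 0 t, |g z| ≤ C) {z : ℝ} (hz : z ∈ Set.Icc 0 t) :
    |truncGamma a b t g z| ≤ a / b * C := by
  have hC0 : 0 ≤ C := (abs_nonneg _).trans (hC z hz)
  have hexp : ∫ w in z..t, C * Real.exp (-b * (w - z))
      = C / b * (1 - Real.exp (-b * (t - z))) := by
    rw [intervalIntegral.integral_eq_sub_of_hasDerivAt
      (f := fun w => -(C / b) * Real.exp (-b * (w - z)))]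
    · simp
      ring
    · intro w _
      have h : HasDerivAt (fun w => -b * (w - z)) (-b * 1) w :=
        ((hasDerivAt_id w).sub_const z).const_mul (-b)
      refine (h.exp.const_mul (-(C / b))).congr_deriv ?_
      field_simp
    · exact Continuous.intervalIntegrable (by fun_prop) _ _
  have hle : |∫ w in z..t, g w * Real.exp (-b * (w - z))|
      ≤ ∫ w in z..t, C * Real.exp (-b * (w - z)) := by
    have hint : IntervalIntegrable (fun w => C * Real.exp (-b * (w - z))) volume z t :=
      Continuous.intervalIntegrable (by fun_prop) _ _
    rw [← Real.norm_eq_abs]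
    refine intervalIntegral.norm_integral_le_of_norm_le hz.2 ?_ hint
    refine Filter.Eventually.of_forall fun w hw => ?_
    rw [Real.norm_eq_abs, abs_mul, Real.abs_exp]
    exact mul_le_mul_of_nonneg_right (hC w ⟨hz.1.trans hw.1.le, hw.2⟩) (Real.exp_pos _).le
  have hone : C / b * (1 - Real.exp (-b * (t - z))) ≤ C / b :=
    mul_le_of_le_one_right (by positivity) (by linarith [Real.exp_pos (-b * (t - z))])
  rw [truncGamma, abs_mul, abs_of_pos ha]
  calc a * |∫ w in z..t, g w * Real.exp (-b * (w - z))| ≤ a * (C / b) :=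
        mul_le_mul_of_nonneg_left (hle.trans (hexp.trans_le hone)) ha.le
    _ = a / b * C := by ring

theorem abs_iterate_truncGamma_le (ha : 0 < a) (hb : 0 < b) {g : ℝ → ℝ} {C : ℝ}
    (hC : ∀ z ∈ Set.Icc 0 t, |g z| ≤ C) (m : ℕ) :
    ∀ z ∈ Set.Icc 0 t, |(truncGamma a b t)^[m] g z| ≤ (a / b) ^ m * C := by
  induction m with
  | zero => simpa using hC
  | succ m ih =>
    intro z hz
    rw [Function.iterate_succ_apply', pow_succ', mul_assoc]
    exact abs_truncGamma_le ha hb ih hz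

theorem exists_abs_le_of_continuous {g : ℝ → ℝ} (hg : Continuous g) (t : ℝ) :
    ∃ C, ∀ z ∈ Set.Icc 0 t, |g z| ≤ C :=
  isCompact_Icc.exists_bound_of_continuousOn hg.continuousOn

theorem truncGamma_eq_of_hasDerivAt {g u : ℝ → ℝ} (hg : Continuous g) (hut : u t = 0)
    (hu : ∀ z, HasDerivAt u ((b - a) * u z - a * g z) z) :
    truncGamma a b t (g + u) = u := by
  have hucont : Continuous u := continuous_iff_continuousAt.2 fun z => (hu z).continuousAt
  funext z
  rw [truncGamma, ← intervalIntegral.integral_const_mul,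
    intervalIntegral.integral_eq_sub_of_hasDerivAt
      (f := fun w => -(u w * Real.exp (-b * (w - z))))]
  · simp [hut]
  · intro w _
    have h : HasDerivAt (fun w => -b * (w - z)) (-b * 1) w :=
      ((hasDerivAt_id w).sub_const z).const_mul (-b)
    refine ((hu w).mul h.exp).fun_neg.congr_deriv ?_
    simp only [Pi.add_apply]
    ring
  · exact Continuous.intervalIntegrable (by fun_prop) _ _

/-- The Neumann series `∑_{m ≥ 1} Γᵐ g` is the solution `u` of
`deriv u z = (b - a) u z - a g z` that vanishes at `t`. -/
theorem hasSum_iterate_truncGamma (ha : 0 < a) (hab : a < b) {g u : ℝ → ℝ} (hg : Continuous g)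
    (hut : u t = 0) (hu : ∀ z, HasDerivAt u ((b - a) * u z - a * g z) z)
    {z : ℝ} (hz : z ∈ Set.Icc 0 t) :
    HasSum (fun m : ℕ => (truncGamma a b t)^[m + 1] g z) (u z) := by
  have hb : 0 < b := ha.trans hab
  have hr0 : 0 ≤ a / b := by positivity
  have hr1 : a / b < 1 := (div_lt_one hb).2 hab
  have hucont : Continuous u := continuous_iff_continuousAt.2 fun z => (hu z).continuousAt
  obtain ⟨C, hC⟩ := exists_abs_le_of_continuous hg t
  obtain ⟨D, hD⟩ := exists_abs_le_of_continuous hucont t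
  have hsummable : Summable fun m : ℕ => (truncGamma a b t)^[m + 1] g z := by
    refine Summable.of_norm_bounded (g := fun m : ℕ => (a / b) ^ (m + 1) * C) ?_
      fun m => abs_iterate_truncGamma_le ha hb hC (m + 1) z hz
    exact ((summable_nat_add_iff 1).2 (summable_geometric_of_lt_one hr0 hr1)).mul_right C
  have hpartial : ∀ M : ℕ, ∑ m ∈ Finset.range M, (truncGamma a b t)^[m + 1] g z
      = u z - (truncGamma a b t)^[M] u z := by
    intro M
    induction M with
    | zero => simp
    | succ M ih =>
      have h : (truncGamma a b t)^[M] u z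
          = (truncGamma a b t)^[M + 1] g z + (truncGamma a b t)^[M + 1] u z := by
        conv_lhs => rw [← truncGamma_eq_of_hasDerivAt hg hut hu, ← Function.iterate_succ_apply,
          iterate_truncGamma_add hg hucont]
        rfl
      rw [Finset.sum_range_succ, ih, h]
      ring
  rw [hsummable.hasSum_iff_tendsto_nat]
  simp only [hpartial]
  have hzero : Filter.Tendsto (fun M : ℕ => (truncGamma a b t)^[M] u z) Filter.atTop (nhds 0) := by
    refine squeeze_zero_norm (fun M => abs_iterate_truncGamma_le ha hb hD M z hz) ?_
    simpa using (tendsto_pow_atTop_nhds_zero_of_lt_one hr0 hr1).mul_const D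
  simpa using tendsto_const_nhds.sub hzero

theorem hasSum_iterate_succ_hawkesGamma (ha : 0 < a) (hab : a < b) {f g u : ℝ → ℝ}
    (hf : ∀ z, 0 ≤ z → f z = if z ≤ t then g z else 0) (hg : Continuous g)
    (hut : u t = 0) (hu : ∀ z, HasDerivAt u ((b - a) * u z - a * g z) z)
    {z : ℝ} (hz : 0 ≤ z) :
    HasSum (fun m : ℕ => (hawkesGamma a b)^[m + 1] f z) (if z ≤ t then u z else 0) := by
  simp only [iterate_hawkesGamma_eq_truncGamma hf _ z hz]
  split_ifs with h
  · exact hasSum_iterate_truncGamma ha hab hg hut hu ⟨hz, h⟩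
  · exact hasSum_zero

theorem hasSum_iterate_hawkesGamma_s16 (ha : 0 < a) (hab : a < b) {f g u : ℝ → ℝ}
    (hf : ∀ z, 0 ≤ z → f z = if z ≤ t then g z else 0) (hg : Continuous g)
    (hut : u t = 0) (hu : ∀ z, HasDerivAt u ((b - a) * u z - a * g z) z)
    {z : ℝ} (hz : z ∈ Set.Icc 0 t) :
    HasSum (fun m : ℕ => (hawkesGamma a b)^[m] f z) (g z + u z) := by
  have h := hasSum_iterate_succ_hawkesGamma ha hab hf hg hut hu hz.1
  rw [if_pos hz.2] at h
  have hfz : f z = g z := by rw [hf z hz.1, if_pos hz.2]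
  simpa [hfz, add_comm] using
    (hasSum_nat_add_iff (f := fun m : ℕ => (hawkesGamma a b)^[m] f z) 1).1 h

end TruncatedOperator

/-- The second cumulant of a single cluster, in terms of `r = a / (b - a)`, the rescaled remaining
time `s = (b - a) (t - z)` and `E = exp (-s)`. -/
noncomputable def hawkesQuasiPoly₂ (r s E : ℝ) : ℝ :=
  (r + 2 * r ^ 2 + r ^ 3) * s ^ 0 * E ^ 0
    + (-r - 2 * r ^ 2) * s ^ 0 * E ^ 1
    + (-(2 * r ^ 2) - 2 * r ^ 3) * s ^ 1 * E ^ 1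
    + (-r ^ 3) * s ^ 0 * E ^ 2

/-- The third cumulant of a single cluster, in the variables of `hawkesQuasiPoly₂`. -/
noncomputable def hawkesQuasiPoly₃ (r s E : ℝ) : ℝ :=
  (r + 6 * r ^ 2 + 12 * r ^ 3 + 10 * r ^ 4 + 3 * r ^ 5) * s ^ 0 * E ^ 0
    + (-r - 6 * r ^ 2 - 6 * r ^ 3 + 3 / 2 * r ^ 4 + 3 / 2 * r ^ 5) * s ^ 0 * E ^ 1
    + (-(6 * r ^ 2) - 18 * r ^ 3 - 15 * r ^ 4 - 3 * r ^ 5) * s ^ 1 * E ^ 1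
    + (-(3 * r ^ 3) - 6 * r ^ 4 - 3 * r ^ 5) * s ^ 2 * E ^ 1
    + (-(6 * r ^ 3) - 12 * r ^ 4 - 3 * r ^ 5) * s ^ 0 * E ^ 2
    + (-(6 * r ^ 4) - 6 * r ^ 5) * s ^ 1 * E ^ 2
    + (1 / 2 * r ^ 4 - 3 / 2 * r ^ 5) * s ^ 0 * E ^ 3

/-- The fourth cumulant of a single cluster minus its immediate contribution
`6 κ₁² κ₂ + 4 κ₁ κ₃ + 3 κ₂² + κ₁⁴`, in the variables of `hawkesQuasiPoly₂`. -/
noncomputable def hawkesQuasiPoly₄ (r s E : ℝ) : ℝ :=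
  (r + 14 * r ^ 2 + 61 * r ^ 3 + 124 * r ^ 4 + 131 * r ^ 5 + 70 * r ^ 6
        + 15 * r ^ 7) * s ^ 0 * E ^ 0
    + (-r - 14 * r ^ 2 - 36 * r ^ 3 - 9 * r ^ 4 + 145 / 3 * r ^ 5 + 136 / 3 * r ^ 6
        + 12 * r ^ 7) * s ^ 0 * E ^ 1
    + (-(14 * r ^ 2) - 86 * r ^ 3 - 174 * r ^ 4 - 148 * r ^ 5 - 52 * r ^ 6
        - 6 * r ^ 7) * s ^ 1 * E ^ 1
    + (-(18 * r ^ 3) - 72 * r ^ 4 - 102 * r ^ 5 - 60 * r ^ 6 - 12 * r ^ 7) * s ^ 2 * E ^ 1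
    + (-(4 * r ^ 4) - 12 * r ^ 5 - 12 * r ^ 6 - 4 * r ^ 7) * s ^ 3 * E ^ 1
    + (-(25 * r ^ 3) - 120 * r ^ 4 - 168 * r ^ 5 - 78 * r ^ 6 - 12 * r ^ 7) * s ^ 0 * E ^ 2
    + (-(60 * r ^ 4) - 180 * r ^ 5 - 156 * r ^ 6 - 36 * r ^ 7) * s ^ 1 * E ^ 2
    + (-(24 * r ^ 5) - 48 * r ^ 6 - 24 * r ^ 7) * s ^ 2 * E ^ 2
    + (5 * r ^ 4 - 11 * r ^ 5 - 40 * r ^ 6 - 12 * r ^ 7) * s ^ 0 * E ^ 3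
    + (6 * r ^ 5 - 12 * r ^ 6 - 18 * r ^ 7) * s ^ 1 * E ^ 3
    + (-(1 / 3 * r ^ 5) + 8 / 3 * r ^ 6 - 3 * r ^ 7) * s ^ 0 * E ^ 4

/-- The primitive in `s` of the fourth cumulant of a single cluster that vanishes at `s = 0`,
in the variables of `hawkesQuasiPoly₂`. -/
noncomputable def hawkesQuasiPolyIntegral (r s E : ℝ) : ℝ :=
  (-(15 * r) - 275 / 2 * r ^ 2 - 2825 / 6 * r ^ 3 - 9685 / 12 * r ^ 4 - 8957 / 12 * r ^ 5
        - 4289 / 12 * r ^ 6 - 279 / 4 * r ^ 7) * s ^ 0 * E ^ 0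
    + (1 + 15 * r + 75 * r ^ 2 + 185 * r ^ 3 + 255 * r ^ 4 + 201 * r ^ 5 + 85 * r ^ 6
        + 15 * r ^ 7) * s ^ 1 * E ^ 0
    + (15 * r + 150 * r ^ 2 + 500 * r ^ 3 + 775 * r ^ 4 + 1859 / 3 * r ^ 5 + 758 / 3 * r ^ 6
        + 42 * r ^ 7) * s ^ 0 * E ^ 1
    + (50 * r ^ 2 + 290 * r ^ 3 + 618 * r ^ 4 + 616 * r ^ 5 + 292 * r ^ 6
        + 54 * r ^ 7) * s ^ 1 * E ^ 1
    + (30 * r ^ 3 + 120 * r ^ 4 + 174 * r ^ 5 + 108 * r ^ 6 + 24 * r ^ 7) * s ^ 2 * E ^ 1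
    + (4 * r ^ 4 + 12 * r ^ 5 + 12 * r ^ 6 + 4 * r ^ 7) * s ^ 3 * E ^ 1
    + (-(25 / 2 * r ^ 2) - 65 / 2 * r ^ 3 + 42 * r ^ 4 + 147 * r ^ 5 + 99 * r ^ 6
        + 21 * r ^ 7) * s ^ 0 * E ^ 2
    + (-(30 * r ^ 3) - 48 * r ^ 4 + 48 * r ^ 5 + 96 * r ^ 6 + 30 * r ^ 7) * s ^ 1 * E ^ 2
    + (-(12 * r ^ 4) - 12 * r ^ 5 + 12 * r ^ 6 + 12 * r ^ 7) * s ^ 2 * E ^ 2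
    + (10 / 3 * r ^ 3 - 29 / 3 * r ^ 4 - 67 / 3 * r ^ 5 + 26 / 3 * r ^ 6
        + 6 * r ^ 7) * s ^ 0 * E ^ 3
    + (4 * r ^ 4 - 10 * r ^ 5 - 8 * r ^ 6 + 6 * r ^ 7) * s ^ 1 * E ^ 3
    + (-(1 / 4 * r ^ 4) + 25 / 12 * r ^ 5 - 35 / 12 * r ^ 6 + 3 / 4 * r ^ 7) * s ^ 0 * E ^ 4

theorem hasDerivAt_pow_mul_exp_pow (c t C : ℝ) (n k : ℕ) (z : ℝ) :
    HasDerivAt (fun z => C * (c * (t - z)) ^ n * Real.exp (-(c * (t - z))) ^ k)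
      (c * (C * (k * (c * (t - z)) ^ n - n * (c * (t - z)) ^ (n - 1))
        * Real.exp (-(c * (t - z))) ^ k)) z := by
  have hs : HasDerivAt (fun z => c * (t - z)) (c * (0 - 1)) z :=
    ((hasDerivAt_const z t).sub (hasDerivAt_id z)).const_mul c
  refine (((hs.fun_pow n).const_mul C).mul (hs.fun_neg.exp.fun_pow k)).congr_deriv ?_
  rcases k with _ | k
  · simp
    ring
  · rw [Nat.add_sub_cancel, pow_succ]
    ring

theorem hasDerivAt_hawkesQuasiPoly₂ (r c t z : ℝ) :
    HasDerivAt (fun z => hawkesQuasiPoly₂ r (c * (t - z)) (Real.exp (-(c * (t - z)))))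
      (c * hawkesQuasiPoly₂ r (c * (t - z)) (Real.exp (-(c * (t - z))))
        - r * c * (1 + r - r * Real.exp (-(c * (t - z)))) ^ 2) z := by
  refine HasDerivAt.congr_deriv (by
    unfold hawkesQuasiPoly₂
    repeat' first | exact hasDerivAt_pow_mul_exp_pow _ _ _ _ _ _ | apply HasDerivAt.fun_add) ?_
  unfold hawkesQuasiPoly₂
  generalize c * (t - z) = s
  generalize Real.exp (-s) = E
  push_cast
  ring

theorem hasDerivAt_hawkesQuasiPoly₃ (r c t z : ℝ) :
    HasDerivAt (fun z => hawkesQuasiPoly₃ r (c * (t - z)) (Real.exp (-(c * (t - z)))))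
      (c * hawkesQuasiPoly₃ r (c * (t - z)) (Real.exp (-(c * (t - z))))
        - r * c * (3 * (1 + r - r * Real.exp (-(c * (t - z))))
            * hawkesQuasiPoly₂ r (c * (t - z)) (Real.exp (-(c * (t - z))))
          + (1 + r - r * Real.exp (-(c * (t - z)))) ^ 3)) z := by
  refine HasDerivAt.congr_deriv (by
    unfold hawkesQuasiPoly₃
    repeat' first | exact hasDerivAt_pow_mul_exp_pow _ _ _ _ _ _ | apply HasDerivAt.fun_add) ?_
  unfold hawkesQuasiPoly₃ hawkesQuasiPoly₂
  generalize c * (t - z) = s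
  generalize Real.exp (-s) = E
  push_cast
  ring

/-- The combination `6 κ₁² κ₂ + 4 κ₁ κ₃ + 3 κ₂² + κ₁⁴` in the variables of `hawkesQuasiPoly₂`. -/
noncomputable def hawkesQuasiPolySource (r s E : ℝ) : ℝ :=
  6 * (1 + r - r * E) ^ 2 * hawkesQuasiPoly₂ r s E
    + 4 * (1 + r - r * E) * hawkesQuasiPoly₃ r s E
    + 3 * hawkesQuasiPoly₂ r s E ^ 2 + (1 + r - r * E) ^ 4

theorem hasDerivAt_hawkesQuasiPoly₄ (r c t z : ℝ) :
    HasDerivAt (fun z => hawkesQuasiPoly₄ r (c * (t - z)) (Real.exp (-(c * (t - z)))))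
      (c * hawkesQuasiPoly₄ r (c * (t - z)) (Real.exp (-(c * (t - z))))
        - r * c * hawkesQuasiPolySource r (c * (t - z)) (Real.exp (-(c * (t - z))))) z := by
  refine HasDerivAt.congr_deriv (by
    unfold hawkesQuasiPoly₄
    repeat' first | exact hasDerivAt_pow_mul_exp_pow _ _ _ _ _ _ | apply HasDerivAt.fun_add) ?_
  unfold hawkesQuasiPolySource hawkesQuasiPoly₄ hawkesQuasiPoly₃ hawkesQuasiPoly₂
  generalize c * (t - z) = s
  generalize Real.exp (-s) = E
  push_cast
  ring

theorem hasDerivAt_hawkesQuasiPolyIntegral (r c t z : ℝ) :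
    HasDerivAt (fun z => hawkesQuasiPolyIntegral r (c * (t - z)) (Real.exp (-(c * (t - z)))))
      (-c * (hawkesQuasiPolySource r (c * (t - z)) (Real.exp (-(c * (t - z))))
        + hawkesQuasiPoly₄ r (c * (t - z)) (Real.exp (-(c * (t - z)))))) z := by
  refine HasDerivAt.congr_deriv (by
    unfold hawkesQuasiPolyIntegral
    repeat' first | exact hasDerivAt_pow_mul_exp_pow _ _ _ _ _ _ | apply HasDerivAt.fun_add) ?_
  unfold hawkesQuasiPolySource hawkesQuasiPoly₄ hawkesQuasiPoly₃ hawkesQuasiPoly₂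
  generalize c * (t - z) = s
  generalize Real.exp (-s) = E
  push_cast
  ring

theorem integral_hawkesQuasiPoly {c : ℝ} (hc : c ≠ 0) (r t : ℝ) :
    ∫ z in (0 : ℝ)..t, (hawkesQuasiPolySource r (c * (t - z)) (Real.exp (-(c * (t - z))))
        + hawkesQuasiPoly₄ r (c * (t - z)) (Real.exp (-(c * (t - z)))))
      = hawkesQuasiPolyIntegral r (c * t) (Real.exp (-(c * t))) / c := by
  rw [intervalIntegral.integral_eq_sub_of_hasDerivAt (f := fun z =>
    -(hawkesQuasiPolyIntegral r (c * (t - z)) (Real.exp (-(c * (t - z)))) / c))]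
  · have h0 : hawkesQuasiPolyIntegral r 0 1 = 0 := by
      unfold hawkesQuasiPolyIntegral
      ring
    simp [h0]
  · intro z _
    refine ((hasDerivAt_hawkesQuasiPolyIntegral r c t z).div_const c).fun_neg.congr_deriv ?_
    field_simp
  · refine Continuous.intervalIntegrable ?_ _ _
    unfold hawkesQuasiPolySource hawkesQuasiPoly₄ hawkesQuasiPoly₃ hawkesQuasiPoly₂
    fun_prop

/-- Fourth cumulant of the Hawkes process with immigration rate `ν`:
`κ⁽⁴⁾(t) = ν ∫₀^t Σ_{m≥0} Γᵐ(6(κ⁽¹⁾)²κ⁽²⁾ + 4κ⁽¹⁾κ⁽³⁾ + 3(κ⁽²⁾)² + (κ⁽¹⁾)⁴)(z) dz`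
equals the stated closed-form expression. -/
theorem hawkes_fourth_cumulant (a b t ν : ℝ) (ha : 0 < a) (hab : a < b) (ht : 0 < t)
    (hν : 0 < ν)
    (κ₁ κ₂ κ₃ : ℝ → ℝ)
    (hκ₁ : κ₁ = Set.indicator (Set.Icc (0 : ℝ) t)
      (fun z => b / (b - a) - a / (b - a) * Real.exp (-(b - a) * (t - z))))
    (hκ₂ : ∀ z : ℝ, κ₂ z = ∑' m : ℕ, (hawkesGamma a b)^[m + 1] (fun w => (κ₁ w) ^ 2) z)
    (hκ₃ : ∀ z : ℝ, κ₃ z = ∑' m : ℕ,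
      (hawkesGamma a b)^[m + 1] (fun w => 3 * κ₁ w * κ₂ w + (κ₁ w) ^ 3) z) :
    ν * ∫ z in (0 : ℝ)..t,
        (∑' m : ℕ, (hawkesGamma a b)^[m]
          (fun w => 6 * (κ₁ w) ^ 2 * κ₂ w + 4 * κ₁ w * κ₃ w + 3 * (κ₂ w) ^ 2
            + (κ₁ w) ^ 4) z)
      = -(ν / (12 * (a - b) ^ 8)) *
          (180 * a * b ^ 6 + 570 * a ^ 2 * b ^ 5 + 100 * a ^ 3 * b ^ 4
            - 15 * a ^ 4 * b ^ 3 + 2 * a ^ 5 * b ^ 2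
            + 12 * b ^ 5 * (6 * a ^ 3 + 2 * a ^ 2 * b - b ^ 3 - 7 * a * b ^ 2) * t
            + 4 * (5 * a ^ 6 * b - 45 * a * b ^ 6 + 3 * a ^ 7 - 59 * a ^ 5 * b ^ 2
                - 180 * a ^ 2 * b ^ 5 + 75 * a ^ 3 * b ^ 4 + 75 * a ^ 4 * b ^ 3
                + 6 * a ^ 2 * b * (5 * a * b ^ 4 - 25 * b ^ 5 + 41 * a ^ 2 * b ^ 3
                    - 22 * a ^ 3 * b ^ 2 - a ^ 4 * b + 2 * a ^ 5) * t
                + 18 * a ^ 3 * b ^ 2 * (10 * a * b ^ 3 - 5 * b ^ 4 - 4 * a ^ 2 * b ^ 2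
                    - 2 * a ^ 3 * b + a ^ 4) * t ^ 2
                + 12 * a ^ 4 * b ^ 3 * (a - b) ^ 3 * t ^ 3) * Real.exp ((a - b) * t)
            + (150 * a ^ 2 * b ^ 5 - 360 * a ^ 3 * b ^ 4 - 564 * a ^ 4 * b ^ 3
                + 588 * a ^ 5 * b ^ 2 + 18 * a ^ 6 * b - 84 * a ^ 7
                + 4 * a ^ 3 * b * (90 * b ^ 4 - 306 * a * b ^ 3 + 180 * a ^ 2 * b ^ 2
                    + 108 * a ^ 3 * b - 72 * a ^ 4) * t
                + 144 * a ^ 4 * b ^ 2 * (-(4 * a * b ^ 2) + b ^ 3 + 5 * a ^ 2 * b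
                    - 2 * a ^ 3) * t ^ 2) * Real.exp (2 * (a - b) * t)
            + (276 * a ^ 4 * b ^ 3 - 40 * a ^ 3 * b ^ 4 - 132 * a ^ 6 * b
                - 320 * a ^ 5 * b ^ 2 + 144 * a ^ 7
                + 24 * a ^ 4 * b * (13 * a * b ^ 2 - 23 * a ^ 2 * b - 2 * b ^ 3
                    + 12 * a ^ 3) * t) * Real.exp (3 * (a - b) * t)
            + a ^ 4 * (3 * b ^ 3 - 34 * a * b ^ 2 + 94 * a ^ 2 * b - 72 * a ^ 3) *
                Real.exp (4 * (a - b) * t)) := by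
  have hc : 0 < b - a := sub_pos.2 hab
  obtain ⟨c, hcdef⟩ : ∃ c, c = b - a := ⟨_, rfl⟩
  have hc0 : c ≠ 0 := by rw [hcdef]; exact hc.ne'
  obtain ⟨r, hr⟩ : ∃ r, r = a / c := ⟨_, rfl⟩
  have hrc : r * c = a := by rw [hr]; field_simp
  have hbc : (1 + r) * c = b := by rw [add_mul, hrc, hcdef]; ring
  have h₁ : ∀ z, 0 ≤ z → κ₁ z =
      if z ≤ t then 1 + r - r * Real.exp (-(c * (t - z))) else 0 := by
    intro z hz
    have hbr : b / c = 1 + r := by rw [← hbc]; field_simp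
    simp only [hκ₁, Set.indicator, Set.mem_Icc, hz, true_and, ← hcdef, hbr, ← hr, neg_mul]
  have h₂ : ∀ z, 0 ≤ z → κ₂ z =
      if z ≤ t then hawkesQuasiPoly₂ r (c * (t - z)) (Real.exp (-(c * (t - z)))) else 0 := by
    intro z hz
    rw [hκ₂]
    refine (hasSum_iterate_succ_hawkesGamma ha hab (t := t)
      (g := fun z => (1 + r - r * Real.exp (-(c * (t - z)))) ^ 2)
      (u := fun z => hawkesQuasiPoly₂ r (c * (t - z)) (Real.exp (-(c * (t - z)))))
      (fun w hw => ?_) (by fun_prop) ?_ (fun w => ?_) hz).tsum_eq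
    · rw [h₁ w hw]
      split_ifs <;> simp
    · simp [hawkesQuasiPoly₂]
      ring
    · rw [← hcdef]
      exact (hasDerivAt_hawkesQuasiPoly₂ r c t w).congr_deriv (by rw [hrc])
  have h₃ : ∀ z, 0 ≤ z → κ₃ z =
      if z ≤ t then hawkesQuasiPoly₃ r (c * (t - z)) (Real.exp (-(c * (t - z)))) else 0 := by
    intro z hz
    rw [hκ₃]
    refine (hasSum_iterate_succ_hawkesGamma ha hab (t := t)
      (g := fun z => 3 * (1 + r - r * Real.exp (-(c * (t - z))))
          * hawkesQuasiPoly₂ r (c * (t - z)) (Real.exp (-(c * (t - z))))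
        + (1 + r - r * Real.exp (-(c * (t - z)))) ^ 3)
      (u := fun z => hawkesQuasiPoly₃ r (c * (t - z)) (Real.exp (-(c * (t - z)))))
      (fun w hw => ?_) (by unfold hawkesQuasiPoly₂; fun_prop) ?_ (fun w => ?_) hz).tsum_eq
    · rw [h₁ w hw, h₂ w hw]
      split_ifs <;> simp
    · simp [hawkesQuasiPoly₃]
      ring
    · rw [← hcdef]
      exact (hasDerivAt_hawkesQuasiPoly₃ r c t w).congr_deriv (by rw [hrc])
  have h₄ : ∀ z ∈ Set.uIcc 0 t, (∑' m : ℕ, (hawkesGamma a b)^[m]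
      (fun w => 6 * (κ₁ w) ^ 2 * κ₂ w + 4 * κ₁ w * κ₃ w + 3 * (κ₂ w) ^ 2 + (κ₁ w) ^ 4) z)
      = hawkesQuasiPolySource r (c * (t - z)) (Real.exp (-(c * (t - z))))
        + hawkesQuasiPoly₄ r (c * (t - z)) (Real.exp (-(c * (t - z)))) := by
    intro z hz
    rw [Set.uIcc_of_le ht.le] at hz
    have hsource : ∀ w, 0 ≤ w →
        6 * (κ₁ w) ^ 2 * κ₂ w + 4 * κ₁ w * κ₃ w + 3 * (κ₂ w) ^ 2 + (κ₁ w) ^ 4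
        = if w ≤ t then hawkesQuasiPolySource r (c * (t - w)) (Real.exp (-(c * (t - w))))
          else 0 := by
      intro w hw
      rw [h₁ w hw, h₂ w hw, h₃ w hw]
      split_ifs <;> simp [hawkesQuasiPolySource]
    exact (hasSum_iterate_hawkesGamma_s16 ha hab hsource
      (u := fun z => hawkesQuasiPoly₄ r (c * (t - z)) (Real.exp (-(c * (t - z)))))
      (by
        unfold hawkesQuasiPolySource hawkesQuasiPoly₃ hawkesQuasiPoly₂
        fun_prop)
      (by
        simp [hawkesQuasiPoly₄]
        ring)
      (fun w => by
        rw [← hcdef]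
        exact (hasDerivAt_hawkesQuasiPoly₄ r c t w).congr_deriv (by rw [hrc])) hz).tsum_eq
  rw [intervalIntegral.integral_congr h₄, integral_hawkesQuasiPoly hc0]
  have hE : ∀ n : ℕ, Real.exp (n * (a - b) * t) = Real.exp (-(c * t)) ^ n := fun n => by
    rw [← Real.exp_nat_mul, hcdef]
    congr 1
    ring
  have hE₁ := hE 1
  have hE₂ := hE 2
  have hE₃ := hE 3
  have hE₄ := hE 4
  push_cast at hE₁ hE₂ hE₃ hE₄
  rw [one_mul] at hE₁
  rw [hE₁, hE₂, hE₃, hE₄, show a - b = -c by rw [hcdef]; ring]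
  generalize Real.exp (-(c * t)) = E
  subst hrc hbc
  unfold hawkesQuasiPolyIntegral
  field_simp
  ring
end

section
/- Fix 0 < a < b, t > 0 and ν > 0, and let e_{0,b}(x) = e^{bx} 1_{[0,t]}(x). Then (i) for every z ∈ [0,t], e^{bz} + Σ_{n=1}^∞ (Γⁿ e_{0,b})(z) = e^{at} e^{(b−a)z}; and (ii) consequently a e^{−bt} ν ∫₀^t e^{at} e^{(b−a)z} dz = (ν a/(b−a)) (1 − e^{(a−b)t}). (The quantity in (ii) is the mean intensity E[λ_t] of the Hawkes process with stochastic intensity λ_t = a ∫₀^t e^{−b(t−s)} dN_s.) -/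
open MeasureTheory

/-- One step of the recursion defining the iterates of `hawkesGamma` on `x ↦ e^{bx} 1_{[0,t]}(x)`. -/
lemma hawkesGamma_of_eq_indicator (a b t : ℝ) (n : ℕ) {f : ℝ → ℝ}
    (hf : ∀ z, 0 ≤ z → f z = (Set.Icc 0 t).indicator
      (fun x => Real.exp (b * x) * ((a * (t - x)) ^ n / n.factorial)) z) {z : ℝ} (hz : 0 ≤ z) :
    hawkesGamma a b f z = (Set.Icc 0 t).indicator
      (fun x => Real.exp (b * x) * ((a * (t - x)) ^ (n + 1) / (n + 1).factorial)) z := by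
  have hcongr : ∫ y in Set.Ioi (0 : ℝ), f (z + y) * Real.exp (-b * y) =
      ∫ y in Set.Ioi (0 : ℝ), (Set.Iic (t - z)).indicator
        (fun y => Real.exp (b * z) * a ^ n / n.factorial * (t - z - y) ^ n) y := by
    refine setIntegral_congr_fun measurableSet_Ioi fun y hy => ?_
    have hy0 : 0 < y := hy
    simp only [hf (z + y) (by linarith)]
    by_cases hyt : y ≤ t - z
    · rw [Set.indicator_of_mem (show z + y ∈ Set.Icc 0 t from ⟨by linarith, by linarith⟩),
        Set.indicator_of_mem (show y ∈ Set.Iic (t - z) from hyt)]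
      have hexp : Real.exp (b * z) = Real.exp (b * (z + y)) * Real.exp (-b * y) := by
        rw [← Real.exp_add]
        ring_nf
      rw [hexp, mul_pow, sub_sub]
      ring
    · rw [Set.indicator_of_notMem (fun h => hyt (by linarith [h.2])),
        Set.indicator_of_notMem (show y ∉ Set.Iic (t - z) from hyt), zero_mul]
  rw [hawkesGamma, hcongr, setIntegral_indicator measurableSet_Iic, Set.Ioi_inter_Iic]
  by_cases hzt : z ≤ t
  · have hpow : ∫ y in (0 : ℝ)..(t - z), (t - z - y) ^ n = (t - z) ^ (n + 1) / (n + 1) := by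
      rw [intervalIntegral.integral_comp_sub_left (fun x => x ^ n) (t - z)]
      simp [integral_pow]
    rw [Set.indicator_of_mem (show z ∈ Set.Icc 0 t from ⟨hz, hzt⟩),
      ← intervalIntegral.integral_of_le (by linarith), intervalIntegral.integral_const_mul, hpow,
      Nat.factorial_succ, mul_pow]
    push_cast
    field_simp
    ring
  · rw [Set.indicator_of_notMem (fun h => hzt h.2), Set.Ioc_eq_empty (by linarith)]
    simp

lemma hawkesGamma_iterate_indicator_exp (a b t : ℝ) (n : ℕ) {z : ℝ} (hz : 0 ≤ z) :
    (hawkesGamma a b)^[n] (Set.indicator (Set.Icc (0 : ℝ) t) fun x => Real.exp (b * x)) z =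
      (Set.Icc 0 t).indicator
        (fun x => Real.exp (b * x) * ((a * (t - x)) ^ n / n.factorial)) z := by
  induction n generalizing z with
  | zero => simp
  | succ n ih =>
    rw [Function.iterate_succ_apply']
    exact hawkesGamma_of_eq_indicator a b t n (fun _ hx => ih hx) hz

/-- For `0 < a < b`, `t > 0`, `ν > 0` and `e_{0,b}(x) = e^{bx} 1_{[0,t]}(x)`:
(i) for every `z ∈ [0,t]`, `e^{bz} + Σ_{n≥1} (Γⁿ e_{0,b})(z) = e^{at} e^{(b-a)z}`; and
(ii) `a e^{-bt} ν ∫₀^t e^{at} e^{(b-a)z} dz = (νa/(b-a))(1 - e^{(a-b)t})`,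
the mean intensity `E[λ_t]` of the Hawkes process. -/
theorem hawkes_mean_intensity (a b t ν : ℝ) (ha : 0 < a) (hab : a < b) (ht : 0 < t)
    (hν : 0 < ν) :
    (∀ z ∈ Set.Icc (0 : ℝ) t,
      Real.exp (b * z) + ∑' n : ℕ,
          (hawkesGamma a b)^[n + 1]
            (Set.indicator (Set.Icc (0 : ℝ) t) fun x => Real.exp (b * x)) z
        = Real.exp (a * t) * Real.exp ((b - a) * z)) ∧
    a * Real.exp (-b * t) *
        (ν * ∫ z in (0 : ℝ)..t, Real.exp (a * t) * Real.exp ((b - a) * z))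
      = ν * a / (b - a) * (1 - Real.exp ((a - b) * t)) := by
  constructor
  · intro z hz
    have hsum : HasSum (fun n : ℕ => Real.exp (b * z) * ((a * (t - z)) ^ n / n.factorial))
        (Real.exp (b * z) * Real.exp (a * (t - z))) := by
      rw [Real.exp_eq_exp_ℝ]
      exact (NormedSpace.expSeries_div_hasSum_exp (a * (t - z))).mul_left _
    have hsplit := hsum.summable.tsum_eq_zero_add
    simp only [hawkesGamma_iterate_indicator_exp a b t _ hz.1, Set.indicator_of_mem hz]
    rw [hsum.tsum_eq] at hsplit
    simp only [pow_zero, Nat.factorial_zero, Nat.cast_one, div_one, mul_one] at hsplit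
    rw [← hsplit, ← Real.exp_add, ← Real.exp_add]
    ring_nf
  · have hba : b - a ≠ 0 := (sub_pos.2 hab).ne'
    have hint : ∫ z in (0 : ℝ)..t, Real.exp ((b - a) * z) =
        (Real.exp ((b - a) * t) - 1) / (b - a) := by
      rw [intervalIntegral.integral_comp_mul_left _ hba, integral_exp]
      simp [div_eq_inv_mul]
    have hone : Real.exp (-b * t) * Real.exp (a * t) * Real.exp ((b - a) * t) = 1 := by
      rw [← Real.exp_add, ← Real.exp_add, Real.exp_eq_one_iff]
      ring
    have hexp : Real.exp ((a - b) * t) = Real.exp (-b * t) * Real.exp (a * t) := by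
      rw [← Real.exp_add]
      ring_nf
    rw [intervalIntegral.integral_const_mul, hint, hexp]
    linear_combination ν * a / (b - a) * hone
end
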